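/- For every oracle A ⊆ ℕ the following are equivalent: (a) there is a function f ≤_T A such that for every total computable function h : ℕ → ℕ there are infinitely many n with f(n) = h(n) (that is, A is in 𝒟(≠*)); (b) A computes a weakly 1-generic element of Cantor space 2^ω. -/

import Mathlib

open Filter

namespace CichonAnalog

/-! ### Oracle computability -/

/-- Partial functions `ℕ →. ℕ` partial recursive relative to the oracle `A ⊆ ℕ`.
This is Mathlib's `Nat.Partrec` with an extra base case for the characteristic
function of the oracle. -/
inductive RecursiveIn (A : Set ℕ) : (ℕ →. ℕ) → Prop
  | zero : RecursiveIn A (pure 0)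
  | succ : RecursiveIn A ↑Nat.succ
  | left : RecursiveIn A ↑fun n : ℕ => n.unpair.1
  | right : RecursiveIn A ↑fun n : ℕ => n.unpair.2
  | oracle : RecursiveIn A ↑fun n : ℕ => A.indicator (fun _ => 1) n
  | pair {f g} : RecursiveIn A f → RecursiveIn A g →
      RecursiveIn A fun n => Nat.pair <$> f n <*> g n
  | comp {f g} : RecursiveIn A f → RecursiveIn A g →
      RecursiveIn A fun n => g n >>= f
  | prec {f g} : RecursiveIn A f → RecursiveIn A g →
      RecursiveIn A (Nat.unpaired fun a n =>
        n.rec (f a) fun y IH => do let i ← IH; g (Nat.pair a (Nat.pair y i)))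
  | rfind {f} : RecursiveIn A f →
      RecursiveIn A fun a => Nat.rfind fun n => (fun m => m = 0) <$> f (Nat.pair a n)

/-- The partial function `f` (between coded spaces) is partial recursive in the oracle `A`. -/
def PartrecIn (A : Set ℕ) {α σ : Type} [Primcodable α] [Primcodable σ] (f : α →. σ) : Prop :=
  RecursiveIn A fun n =>
    Part.bind ↑(Encodable.decode (α := α) n) fun a => (f a).map Encodable.encode

/-- `f ≤_T A` : the (total) function `f` is computable from the oracle `A`. -/
def ComputableIn (A : Set ℕ) {α σ : Type} [Primcodable α] [Primcodable σ] (f : α → σ) : Prop :=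
  PartrecIn A (f : α →. σ)

/-- `W` is computably enumerable in the oracle `A`. -/
def CEIn (A : Set ℕ) {α : Type} [Primcodable α] (W : Set α) : Prop :=
  ∃ f : α →. ℕ, PartrecIn A f ∧ ∀ a, a ∈ W ↔ (f a).Dom

/-- `W` is computably enumerable (unrelativized). -/
def CE {α : Type} [Primcodable α] (W : Set α) : Prop :=
  ∃ f : α →. ℕ, Partrec f ∧ ∀ a, a ∈ W ↔ (f a).Dom

/-! ### Cantor space, `Π⁰₁` classes, effective meagerness -/

/-- The basic clopen set (cylinder) of the finite binary string `σ` in Cantor space. -/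
def Cyl (σ : List Bool) : Set (ℕ → Bool) :=
  {x | ∀ i, i < σ.length → x i = σ.getD i false}

/-- `P` is a `Π⁰₁(A)` class: a closed subset of Cantor space whose complement is the
union of basic clopen sets over a set of strings c.e. in `A`. -/
def Pi01In (A : Set ℕ) (P : Set (ℕ → Bool)) : Prop :=
  ∃ W : Set (List Bool), CEIn A W ∧ P = (⋃ σ ∈ W, Cyl σ)ᶜ

/-- `P` is a (plain) `Π⁰₁` class. -/
def Pi01 (P : Set (ℕ → Bool)) : Prop :=
  ∃ W : Set (List Bool), CE W ∧ P = (⋃ σ ∈ W, Cyl σ)ᶜ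

/-- `C` is a uniformly `Π⁰₁(A)` sequence of classes. -/
def UnifPi01In (A : Set ℕ) (C : ℕ → Set (ℕ → Bool)) : Prop :=
  ∃ W : Set (ℕ × List Bool), CEIn A W ∧
    ∀ m, C m = (⋃ σ ∈ {s | (m, s) ∈ W}, Cyl σ)ᶜ

/-- `C` is a uniformly `Π⁰₁` sequence of classes. -/
def UnifPi01 (C : ℕ → Set (ℕ → Bool)) : Prop :=
  ∃ W : Set (ℕ × List Bool), CE W ∧
    ∀ m, C m = (⋃ σ ∈ {s | (m, s) ∈ W}, Cyl σ)ᶜ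

/-- `S` is effectively meager relative to `A`: it is contained in the union of a
uniformly `Π⁰₁(A)` sequence of nowhere dense classes. -/
def EffMeagerIn (A : Set ℕ) (S : Set (ℕ → Bool)) : Prop :=
  ∃ C : ℕ → Set (ℕ → Bool), UnifPi01In A C ∧ (∀ m, IsNowhereDense (C m)) ∧ S ⊆ ⋃ m, C m

/-- `S` is effectively meager (unrelativized). -/
def EffMeager (S : Set (ℕ → Bool)) : Prop :=
  ∃ C : ℕ → Set (ℕ → Bool), UnifPi01 C ∧ (∀ m, IsNowhereDense (C m)) ∧ S ⊆ ⋃ m, C m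

/-- `A` is meager engulfing: some `A`-effectively meager set contains every
effectively meager set. -/
def MeagerEngulfing (A : Set ℕ) : Prop :=
  ∃ S, EffMeagerIn A S ∧ ∀ T, EffMeager T → T ⊆ S

/-- `A` is weakly meager engulfing: some `A`-effectively meager set contains every
computable element of Cantor space. -/
def WeaklyMeagerEngulfing (A : Set ℕ) : Prop :=
  ∃ S, EffMeagerIn A S ∧ ∀ x : ℕ → Bool, Computable x → x ∈ S

/-- `V` is a computable set of finite binary strings. -/
def ComputableStringSet (V : Set (List Bool)) : Prop :=
  ∃ χ : List Bool → Bool, Computable χ ∧ ∀ s, s ∈ V ↔ χ s = true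

/-- `V` is a dense set of finite binary strings: every string has an extension in `V`. -/
def DenseStringSet (V : Set (List Bool)) : Prop :=
  ∀ σ : List Bool, ∃ τ ∈ V, σ <+: τ

/-- `x ∈ 2^ω` is weakly 1-generic: for every computable dense set `V` of finite
binary strings, some initial segment of `x` lies in `V`. -/
def Weakly1Generic (x : ℕ → Bool) : Prop :=
  ∀ V : Set (List Bool), ComputableStringSet V → DenseStringSet V →
    ∃ n, (List.ofFn fun i : Fin n => x i) ∈ V

/-! ### Domination properties -/

/-- `A` is high: `A` computes a function dominating every total computable function. -/
def High (A : Set ℕ) : Prop :=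
  ∃ f : ℕ → ℕ, ComputableIn A f ∧
    ∀ g : ℕ → ℕ, Computable g → ∀ᶠ n in atTop, g n ≤ f n

/-- `A` is of hyperimmune degree: `A` computes a function not dominated by any
computable function. -/
def HyperimmuneDegree (A : Set ℕ) : Prop :=
  ∃ f : ℕ → ℕ, ComputableIn A f ∧
    ∀ g : ℕ → ℕ, Computable g → ∃ᶠ n in atTop, g n < f n

/-- `A` is of hyperimmune-free degree: every function computable in `A` is dominated
by a total computable function. -/
def HyperimmuneFree (A : Set ℕ) : Prop :=
  ∀ f : ℕ → ℕ, ComputableIn A f →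
    ∃ g : ℕ → ℕ, Computable g ∧ ∀ᶠ n in atTop, f n ≤ g n

/-! ### Measure on Cantor space, Kurtz and Schnorr tests -/

open scoped Classical in
/-- The uniform measure of the clopen set `⋃ σ ∈ F, [σ]` determined by the finite
list `F` of binary strings: count the binary strings of maximal length extending
some member of `F`, and normalize. -/
noncomputable def listMeasure (F : List (List Bool)) : ℚ :=
  letI k := (F.map List.length).foldr max 0
  ((Finset.univ.filter fun v : Fin k → Bool =>
      ∃ σ ∈ F, σ <+: List.ofFn v).card : ℚ) / 2 ^ k

/-- The clopen subset of Cantor space given explicitly as a finite union of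
basic clopen sets. -/
def ClopSet (F : List (List Bool)) : Set (ℕ → Bool) := ⋃ σ ∈ F, Cyl σ

/-- The effectively open subset of Cantor space enumerated by the sequence of
finite stages `g`. -/
def OpenSet (g : ℕ → List (List Bool)) : Set (ℕ → Bool) := ⋃ s, ClopSet (g s)

/-- The measure of the open set enumerated by the stages `g`: the supremum of the
measures of its finite partial unions. -/
noncomputable def openMeasure (g : ℕ → List (List Bool)) : ℝ :=
  ⨆ s : ℕ, (listMeasure ((List.range (s + 1)).flatMap g) : ℝ)

/-- A Kurtz test relative to `A`: an `A`-computable sequence of explicitly given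
clopen sets, the `m`-th of measure at most `2 ^ (-m)`. -/
def KurtzTestIn (A : Set ℕ) (G : ℕ → List (List Bool)) : Prop :=
  ComputableIn A G ∧ ∀ m, listMeasure (G m) ≤ (1 / 2) ^ m

/-- A (plain) Kurtz test. -/
def KurtzTest (G : ℕ → List (List Bool)) : Prop :=
  Computable G ∧ ∀ m, listMeasure (G m) ≤ (1 / 2) ^ m

/-- A Schnorr test relative to `A`: an `A`-computable doubly indexed sequence of finite
stages such that the `m`-th effectively open set `⋃ s, ClopSet (g m s)` has measure at
most `2 ^ (-m)`, and this measure is a real computable in `A` uniformly in `m`. -/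
def SchnorrTestIn (A : Set ℕ) (g : ℕ → ℕ → List (List Bool)) : Prop :=
  ComputableIn A (fun p : ℕ × ℕ => g p.1 p.2) ∧
  (∀ m, openMeasure (g m) ≤ (1 / 2) ^ m) ∧
  ∃ q : ℕ × ℕ → ℚ, ComputableIn A q ∧
    ∀ m k, |openMeasure (g m) - (q (m, k) : ℝ)| ≤ (1 / 2) ^ k

/-- A (plain) Schnorr test. -/
def SchnorrTest (g : ℕ → ℕ → List (List Bool)) : Prop :=
  Computable (fun p : ℕ × ℕ => g p.1 p.2) ∧
  (∀ m, openMeasure (g m) ≤ (1 / 2) ^ m) ∧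
  ∃ q : ℕ × ℕ → ℚ, Computable q ∧
    ∀ m k, |openMeasure (g m) - (q (m, k) : ℝ)| ≤ (1 / 2) ^ k

/-- `N` is Schnorr null relative to `A`. -/
def SchnorrNullIn (A : Set ℕ) (N : Set (ℕ → Bool)) : Prop :=
  ∃ g, SchnorrTestIn A g ∧ N ⊆ ⋂ m, OpenSet (g m)

/-- `N` is Schnorr null (unrelativized). -/
def SchnorrNull (N : Set (ℕ → Bool)) : Prop :=
  ∃ g, SchnorrTest g ∧ N ⊆ ⋂ m, OpenSet (g m)

/-- `x ∈ 2^ω` is Schnorr random: it belongs to no Schnorr null set. -/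
def SchnorrRandom (x : ℕ → Bool) : Prop := ∀ N, SchnorrNull N → x ∉ N

/-- `A` is Kurtz engulfing: there is an `A`-computable sequence of Kurtz tests relative
to `A` such that every Kurtz null set is contained in the null set of one of them. -/
def KurtzEngulfing (A : Set ℕ) : Prop :=
  ∃ G : ℕ → ℕ → List (List Bool),
    ComputableIn A (fun p : ℕ × ℕ => G p.1 p.2) ∧
    (∀ i m, listMeasure (G i m) ≤ (1 / 2) ^ m) ∧
    ∀ L, KurtzTest L → ∃ i, (⋂ m, ClopSet (L m)) ⊆ ⋂ m, ClopSet (G i m)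

/-- `A` is weakly Kurtz engulfing: there is an `A`-computable sequence of Kurtz tests
relative to `A` such that the union of their null sets contains every computable
element of Cantor space. -/
def WeaklyKurtzEngulfing (A : Set ℕ) : Prop :=
  ∃ G : ℕ → ℕ → List (List Bool),
    ComputableIn A (fun p : ℕ × ℕ => G p.1 p.2) ∧
    (∀ i m, listMeasure (G i m) ≤ (1 / 2) ^ m) ∧
    ∀ x : ℕ → Bool, Computable x → ∃ i, x ∈ ⋂ m, ClopSet (G i m)

/-- `A` is weakly Schnorr engulfing: some set Schnorr null relative to `A` contains
every computable element of Cantor space. -/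
def WeaklySchnorrEngulfing (A : Set ℕ) : Prop :=
  ∃ N, SchnorrNullIn A N ∧ ∀ x : ℕ → Bool, Computable x → x ∈ N

/-! ### DNR and PA degrees -/

/-- The `e`-th partial computable function. -/
noncomputable def phi (e : ℕ) : ℕ →. ℕ := (Denumerable.ofNat Nat.Partrec.Code e).eval

/-- `h` is diagonally nonrecursive. -/
def DNRFun (h : ℕ → ℕ) : Prop := ∀ e, ∀ y ∈ phi e e, h e ≠ y

/-- `A` is DNR: `A` computes a diagonally nonrecursive function. -/
def DNRDegree (A : Set ℕ) : Prop := ∃ h : ℕ → ℕ, ComputableIn A h ∧ DNRFun h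

/-- `A` is PA: `A` computes a `{0,1}`-valued diagonally nonrecursive function. -/
def PA (A : Set ℕ) : Prop :=
  ∃ h : ℕ → ℕ, ComputableIn A h ∧ (∀ e, h e ≤ 1) ∧ DNRFun h

/-! ### Traces -/

/-- The trace `σ` (satisfying `|σ n| ≤ n`) traces the function `f` if
`f n ∈ σ n` for all but finitely many `n`. -/
def Traces (σ : ℕ → Finset ℕ) (f : ℕ → ℕ) : Prop := ∀ᶠ n in atTop, f n ∈ σ n

/-- `σ` is a `(D, g)`-trace relative to `A`: `D` is infinite and c.e. in `A`, `g` is a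
partial `A`-computable function with `D ⊆ dom g` and `g n ≥ n` on its domain, and `σ`
is partial `A`-computable, defined on `D`, with `|σ n| < g n` for all `n ∈ D`. -/
def IsDGTraceIn (A : Set ℕ) (D : Set ℕ) (g : ℕ →. ℕ) (σ : ℕ →. Finset ℕ) : Prop :=
  D.Infinite ∧ CEIn A D ∧ PartrecIn A g ∧ D ⊆ g.Dom ∧ (∀ n, ∀ y ∈ g n, n ≤ y) ∧
  PartrecIn A σ ∧ D ⊆ σ.Dom ∧ ∀ n ∈ D, ∀ S ∈ σ n, ∀ b ∈ g n, S.card < b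

/-- `σ` is a `(D, g)`-trace (unrelativized). -/
def IsDGTrace (D : Set ℕ) (g : ℕ →. ℕ) (σ : ℕ →. Finset ℕ) : Prop :=
  D.Infinite ∧ CE D ∧ Partrec g ∧ D ⊆ g.Dom ∧ (∀ n, ∀ y ∈ g n, n ≤ y) ∧
  Partrec σ ∧ D ⊆ σ.Dom ∧ ∀ n ∈ D, ∀ S ∈ σ n, ∀ b ∈ g n, S.card < b

/-- The `(D, g)`-trace `σ` traces `f`: `f n ∈ σ n` for all but finitely many `n ∈ D`. -/
def DGTraces (D : Set ℕ) (σ : ℕ →. Finset ℕ) (f : ℕ → ℕ) : Prop :=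
  ∀ᶠ n in atTop, n ∈ D → ∀ S ∈ σ n, f n ∈ S

/-! ### Closure properties of oracle computability -/

section OracleClosure

open Encodable

variable {A : Set ℕ} {α β γ : Type} [Primcodable α] [Primcodable β] [Primcodable γ]

theorem RecursiveIn.of_eq {f g : ℕ →. ℕ} (hf : RecursiveIn A f) (H : ∀ n, f n = g n) :
    RecursiveIn A g :=
  (funext H : f = g) ▸ hf

theorem RecursiveIn.of_partrec {f : ℕ →. ℕ} (hf : Nat.Partrec f) : RecursiveIn A f := by
  induction hf with
  | zero => exact .zero
  | succ => exact .succ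
  | left => exact .left
  | right => exact .right
  | pair _ _ ihf ihg => exact .pair ihf ihg
  | comp _ _ ihf ihg => exact .comp ihf ihg
  | prec _ _ ihf ihg => exact .prec ihf ihg
  | rfind _ ihf => exact .rfind ihf

theorem ComputableIn.of_computable {f : α → β} (hf : Computable f) : ComputableIn A f :=
  RecursiveIn.of_partrec hf

theorem ComputableIn.comp {f : β → γ} {g : α → β} (hf : ComputableIn A f)
    (hg : ComputableIn A g) : ComputableIn A fun a => f (g a) := by
  refine (RecursiveIn.comp hf hg).of_eq fun n => ?_
  cases decode (α := α) n <;> simp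

theorem ComputableIn.pair {f : α → β} {g : α → γ} (hf : ComputableIn A f)
    (hg : ComputableIn A g) : ComputableIn A fun a => (f a, g a) := by
  refine (RecursiveIn.pair hf hg).of_eq fun n => ?_
  cases decode (α := α) n <;> simp [Seq.seq]

theorem ComputableIn.iff_recursiveIn {f : ℕ → ℕ} : ComputableIn A f ↔ RecursiveIn A f := by
  unfold ComputableIn PartrecIn
  exact iff_of_eq (congrArg _ (funext fun n => by simp))

/-- Iterating a computable operation along an `A`-computable sequence of parameters. -/
theorem ComputableIn.iterate {f : ℕ → ℕ} {φ : ℕ → α → α} {u : ℕ → α} (hf : ComputableIn A f)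
    (hφ : Computable₂ φ) (hu : ∀ n, u (n + 1) = φ (f n) (u n)) : ComputableIn A u := by
  let step : ℕ × ℕ → ℕ := fun p => ((decode (α := α) p.2).map fun a => encode (φ p.1 a)).getD 0
  have hstep : Computable step :=
    Computable.option_getD
      (Computable.option_map (Computable.decode.comp Computable.snd)
        (Computable.encode.comp
          (hφ.comp (Computable.fst.comp Computable.fst) Computable.snd)).to₂)
      (Computable.const 0)
  let g : ℕ → ℕ := fun n => step (f n.unpair.2.unpair.1, n.unpair.2.unpair.2)
  have hright : ComputableIn A fun n : ℕ => n.unpair.2.unpair :=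
    .of_computable (Computable.unpair.comp (Computable.snd.comp Computable.unpair))
  have hg : ComputableIn A g :=
    (ComputableIn.of_computable hstep).comp
      ((hf.comp ((ComputableIn.of_computable Computable.fst).comp hright)).pair
        ((ComputableIn.of_computable Computable.snd).comp hright))
  have hinit : ComputableIn A fun _ : ℕ => encode (u 0) := .of_computable (Computable.const _)
  have hpair : ComputableIn A fun n : ℕ => Nat.pair 0 n :=
    .of_computable (Primrec₂.natPair.comp (Primrec.const 0) Primrec.id).to_comp
  have hrec := RecursiveIn.comp
    (RecursiveIn.prec (ComputableIn.iff_recursiveIn.1 hinit) (ComputableIn.iff_recursiveIn.1 hg))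
    (ComputableIn.iff_recursiveIn.1 hpair)
  refine hrec.of_eq fun n => ?_
  simp only [PFun.coe_val, Part.bind_eq_bind, Part.bind_some, Nat.unpaired, Nat.unpair_pair,
    decode_nat, Part.coe_some, Part.map_some]
  induction n with
  | zero => rfl
  | succ n ih =>
    refine (congrArg (fun o : Part ℕ => o.bind _) ih).trans ?_
    simp [g, step, hu]

/-- Unbounded search in an `A`-computable predicate. -/
theorem ComputableIn.find {p : ℕ → ℕ → Bool} (hp : ComputableIn A fun q : ℕ × ℕ => p q.1 q.2)
    (h : ∀ a, ∃ n, p a n = true) : ComputableIn A fun a => Nat.find (h a) := by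
  have hneg : ComputableIn A fun n : ℕ => bif p n.unpair.1 n.unpair.2 then 0 else 1 := by
    have hb : Computable fun b : Bool => (bif b then 0 else 1 : ℕ) :=
      (Primrec.dom_finite _).to_comp
    exact (ComputableIn.of_computable hb).comp
      (hp.comp (.of_computable Computable.unpair))
  refine ComputableIn.iff_recursiveIn.2
    ((RecursiveIn.rfind (ComputableIn.iff_recursiveIn.1 hneg)).of_eq fun a => ?_)
  refine Part.eq_some_iff.2 (Nat.mem_rfind.2 ⟨?_, fun {m} hm => ?_⟩)
  · simp [Nat.find_spec (h a)]
  · simp [Nat.find_min (h a) hm]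

theorem computable_find {p : α → ℕ → Bool} (hp : Computable₂ p)
    (h : ∀ a, ∃ n, p a n = true) : Computable fun a => Nat.find (h a) :=
  (Partrec.rfind hp.partrec₂).of_eq_tot fun a => Nat.mem_rfind.2
    ⟨by simp [Nat.find_spec (h a)], fun {m} hm => by simpa using Nat.find_min (h a) hm⟩

end OracleClosure

/-! ### Bounded suprema -/

/-- The maximum of `F k` over `k < n`. -/
def supBelow (F : ℕ → ℕ) (n : ℕ) : ℕ := n.rec 0 fun k m => max m (F k)

theorem lt_supBelow {F : ℕ → ℕ} {n m : ℕ} : m < supBelow F n ↔ ∃ k < n, m < F k := by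
  induction n with
  | zero => simp [supBelow]
  | succ n ih =>
    have : supBelow F (n + 1) = max (supBelow F n) (F n) := rfl
    simp only [this, lt_max_iff, ih, Nat.lt_succ_iff_lt_or_eq]
    grind

theorem le_supBelow (F : ℕ → ℕ) {n k : ℕ} (h : k < n) : F k ≤ supBelow F n := by
  by_contra! hlt
  exact lt_irrefl _ (lt_supBelow.2 ⟨k, h, hlt⟩)

theorem computable_supBelow {α : Type} [Primcodable α] {F : α → ℕ → ℕ} {b : α → ℕ}
    (hF : Computable₂ F) (hb : Computable b) : Computable fun a => supBelow (F a) (b a) :=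
  Computable.nat_rec hb (Computable.const 0)
    (Primrec.nat_max.to_comp.comp (Computable.snd.comp Computable.snd)
      (hF.comp Computable.fst (Computable.fst.comp Computable.snd))).to₂

/-! ### Weakly 1-generic sets give functions infinitely often equal to computable ones -/

theorem computableStringSet_of_supBelow {F : List Bool → ℕ → ℕ} (hF : Computable₂ F) :
    ComputableStringSet {σ | ∃ n < σ.length, 0 < F σ n} := by
  refine ⟨fun σ => decide (0 < supBelow (F σ) σ.length), ?_, fun σ => by simp [lt_supBelow]⟩
  exact (Primrec.nat_lt.decide.to_comp).comp (Computable.const 0)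
    (computable_supBelow hF Computable.list_length)

theorem computable_getElem?_eq {α : Type} [Primcodable α] {l : α → List Bool} {i : α → ℕ}
    (hl : Computable l) (hi : Computable i) (b : Bool) :
    Computable fun a => decide ((l a)[i a]? = some b) :=
  Primrec.eq.decide.to_comp.comp (Computable.list_getElem?.comp hl hi) (Computable.const (some b))

/-- Above any `N`, a weakly 1-generic `x` has a position `n` followed by exactly `h n` zeros
and then a one. -/
theorem Weakly1Generic.exists_gap {x : ℕ → Bool} (hx : Weakly1Generic x) {h : ℕ → ℕ}
    (hh : Computable h) (N : ℕ) :
    ∃ n ≥ N, (∀ i < h n, x (n + i) = false) ∧ x (n + h n) = true := by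
  let zeros : List Bool × ℕ → ℕ → ℕ := fun p i =>
    bif decide (p.1[p.2 + i]? = some false) then 0 else 1
  let F : List Bool → ℕ → ℕ := fun σ n =>
    bif decide (N ≤ n) && decide (σ[n + h n]? = some true) &&
      decide (supBelow (zeros (σ, n)) (h n) = 0) then 1 else 0
  have hadd : Computable₂ fun n k : ℕ => n + k := Primrec.nat_add.to_comp
  have hzeros : Computable₂ zeros := by
    have hb := computable_getElem?_eq (Computable.fst.comp Computable.fst)
      (hadd.comp (Computable.snd.comp Computable.fst) Computable.snd) false
      (α := (List Bool × ℕ) × ℕ)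
    exact (Computable.cond hb (Computable.const 0) (Computable.const 1)).to₂
  have hFc : Computable₂ F := by
    have hle : Computable fun q : List Bool × ℕ => decide (N ≤ q.2) :=
      Primrec.nat_le.decide.to_comp.comp (Computable.const N) Computable.snd
    have hb := computable_getElem?_eq Computable.fst
      (hadd.comp Computable.snd (hh.comp Computable.snd)) true (α := List Bool × ℕ)
    have hz : Computable fun q : List Bool × ℕ => supBelow (zeros q) (h q.2) :=
      computable_supBelow hzeros (hh.comp Computable.snd)
    have hd : Computable fun q : List Bool × ℕ => decide (supBelow (zeros q) (h q.2) = 0) :=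
      Primrec.eq.decide.to_comp.comp hz (Computable.const 0)
    exact (Computable.cond (Primrec.and.to_comp.comp (Primrec.and.to_comp.comp hle hb) hd)
      (Computable.const 1) (Computable.const 0)).to₂
  have hF (σ : List Bool) (n : ℕ) : 0 < F σ n ↔
      N ≤ n ∧ σ[n + h n]? = some true ∧ ∀ i < h n, σ[n + i]? = some false := by
    have hz : supBelow (zeros (σ, n)) (h n) = 0 ↔ ∀ i < h n, σ[n + i]? = some false := by
      rw [← not_iff_not, ← ne_eq, ← Nat.pos_iff_ne_zero, lt_supBelow]
      push Not
      refine exists_congr fun i => and_congr_right fun _ => ?_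
      simp only [zeros]
      grind
    simp only [F]
    grind
  have hdense : DenseStringSet {σ | ∃ n < σ.length, 0 < F σ n} := by
    intro σ
    refine ⟨σ ++ List.replicate N false ++ List.replicate (h (σ.length + N)) false ++ [true],
      ⟨σ.length + N, by simp, (hF _ _).2 ⟨by omega, ?_, fun i hi => ?_⟩⟩, by simp⟩
    · rw [List.getElem?_append_right (by simp; omega)]
      simp [add_assoc]
    · rw [List.getElem?_append_left (by simp; omega), List.getElem?_append_right (by simp)]
      simp [hi]
  obtain ⟨m, n, -, hn⟩ := hx _ (computableStringSet_of_supBelow hFc) hdense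
  obtain ⟨hN, h1, h0⟩ := (hF _ _).1 hn
  exact ⟨n, hN, fun i hi => by have := h0 i hi; grind, by grind⟩

theorem Weakly1Generic.exists_infinitely_often_equal {A : Set ℕ} {x : ℕ → Bool}
    (hxA : ComputableIn A x) (hx : Weakly1Generic x) :
    ∃ f : ℕ → ℕ, ComputableIn A f ∧ ∀ h : ℕ → ℕ, Computable h → ∃ᶠ n in atTop, f n = h n := by
  have hone (n : ℕ) : ∃ i, x (n + i) = true := by
    obtain ⟨m, hm, -, h1⟩ := hx.exists_gap (Computable.const 0) n
    exact ⟨m - n, by rwa [Nat.add_sub_cancel' hm]⟩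
  refine ⟨fun n => Nat.find (hone n),
    ComputableIn.find (p := fun n i => x (n + i)) (hxA.comp (.of_computable
      (Primrec.nat_add.to_comp.comp Computable.fst Computable.snd))) hone,
    fun h hh => frequently_atTop.2 fun N => ?_⟩
  obtain ⟨n, hn, h0, h1⟩ := hx.exists_gap hh N
  exact ⟨n, hn, (Nat.find_eq_iff _).2 ⟨h1, fun i hi => by simp [h0 i hi]⟩⟩

/-! ### Functions infinitely often equal to computable ones give weakly 1-generic sets -/

section Generic

open Encodable
open Nat.Partrec (Code)

/-- If `f` is not dominated by any computable function, it is not dominated either by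
a computable function of the states obtained by iterating a computable operation along `f`. -/
theorem frequently_le_of_iterate {S : Type} [Primcodable S] {f : ℕ → ℕ}
    (hf : ∀ g : ℕ → ℕ, Computable g → ∃ᶠ n in atTop, g n ≤ f n)
    {φ : ℕ → S → S} (hφ : Computable₂ φ) {u : ℕ → S} (hu : ∀ n, u (n + 1) = φ (f n) (u n))
    {t : S → ℕ} (ht : Computable t) : ∃ᶠ n in atTop, t (u n) ≤ f n := by
  by_contra hcon
  simp only [not_frequently, not_le, eventually_atTop] at hcon
  obtain ⟨s, hs⟩ := hcon
  let time : ℕ → ℕ := fun m => ((decode (α := S) m).map t).getD 0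
  let next : ℕ × ℕ → ℕ → ℕ := fun p m =>
    ((decode (α := S) m).map fun a => encode (φ p.1 a)).getD 0
  let T : ℕ → ℕ := fun N => supBelow time (N + 1)
  let row : ℕ → ℕ → ℕ := fun N b => supBelow (next (b, N)) (N + 1)
  let B : ℕ → ℕ := fun k => k.rec (encode (u s)) fun _ N => supBelow (row N) (T N)
  have htime : Computable time :=
    Computable.option_getD
      (Computable.option_map Computable.decode (ht.comp Computable.snd).to₂) (Computable.const 0)
  have hnext : Computable₂ next :=
    (Computable.option_getD
      (Computable.option_map (Computable.decode.comp Computable.snd)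
        (Computable.encode.comp
          (hφ.comp (Computable.fst.comp (Computable.fst.comp Computable.fst))
            Computable.snd)).to₂)
      (Computable.const 0)).to₂
  have hT : Computable T :=
    computable_supBelow (F := fun _ => time) (htime.comp Computable.snd).to₂ Computable.succ
  have hrow : Computable₂ row :=
    (computable_supBelow (F := fun p : ℕ × ℕ => next (p.2, p.1))
      (hnext.comp ((Computable.snd.comp Computable.fst).pair (Computable.fst.comp Computable.fst))
        Computable.snd).to₂
      (Computable.succ.comp Computable.fst)).to₂
  have hB : Computable B :=
    Computable.nat_rec Computable.id (Computable.const _)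
      ((computable_supBelow hrow hT).comp (Computable.snd.comp Computable.snd)).to₂
  have hlt (k : ℕ) (hk : encode (u (s + k)) ≤ B k) : f (s + k) < T (B k) :=
    (hs _ (Nat.le_add_right s k)).trans_le <| by
      have := le_supBelow time (Nat.lt_succ_of_le hk)
      simpa [time] using this
  have hbound (k : ℕ) : encode (u (s + k)) ≤ B k := by
    induction k with
    | zero => exact le_rfl
    | succ k ih =>
      have h1 := le_supBelow (next (f (s + k), B k)) (Nat.lt_succ_of_le ih)
      have h2 := le_supBelow (row (B k)) (hlt k ih)
      have h3 : next (f (s + k), B k) (encode (u (s + k))) = encode (u (s + (k + 1))) := by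
        simp [next, ← add_assoc, hu]
      exact h3 ▸ h1.trans h2
  obtain ⟨n, hn, hle⟩ := frequently_atTop.1
    (hf (fun n => T (B (n - s)))
      (hT.comp (hB.comp (Primrec.nat_sub.to_comp.comp Computable.id (Computable.const s))))) s
  have := hlt (n - s) (hbound _)
  rw [Nat.add_sub_cancel' hn] at this
  exact absurd hle this.not_ge

/-- The first value `some b` taken by `g` below `n`, if any. -/
def firstBelow {β : Type} (g : ℕ → Option β) (n : ℕ) : Option β :=
  n.rec none fun k o => o <|> g k

theorem exists_of_firstBelow_eq_some {β : Type} {g : ℕ → Option β} {n : ℕ} {b : β}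
    (h : firstBelow g n = some b) : ∃ k < n, g k = some b := by
  induction n with
  | zero => simp [firstBelow] at h
  | succ n ih =>
    have hsucc : firstBelow g (n + 1) = (firstBelow g n <|> g n) := rfl
    rw [hsucc] at h
    cases ho : firstBelow g n with
    | none => exact ⟨n, n.lt_succ_self, by simpa [ho] using h⟩
    | some c =>
      obtain ⟨k, hk, hg⟩ := ih (by simpa [ho] using h)
      exact ⟨k, hk.trans n.lt_succ_self, hg⟩

theorem exists_firstBelow_of_eq_some {β : Type} {g : ℕ → Option β} {n k : ℕ} {b : β}
    (hk : k < n) (h : g k = some b) :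
    ∃ j ≤ k, ∃ c, firstBelow g n = some c ∧ g j = some c := by
  induction n with
  | zero => omega
  | succ n ih =>
    have hsucc : firstBelow g (n + 1) = (firstBelow g n <|> g n) := rfl
    rcases Nat.lt_succ_iff_lt_or_eq.1 hk with hlt | rfl
    · obtain ⟨j, hj, c, hc, hg⟩ := ih hlt
      exact ⟨j, hj, c, by simp [hsucc, hc], hg⟩
    · cases ho : firstBelow g k with
      | none => exact ⟨k, le_rfl, b, by simp [hsucc, ho, h], h⟩
      | some c =>
        obtain ⟨j, hj, hg⟩ := exists_of_firstBelow_eq_some ho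
        exact ⟨j, hj.le, c, by simp [hsucc, ho], hg⟩

/-- A stage of the construction: the string built so far, and the requirements already met. -/
abbrev Stage : Type := List Bool × List ℕ

/-- The extension of the current string requested by the unmet requirement `e`, if the `e`-th
code produces it within `b` steps. -/
def request (b : ℕ) (p : Stage) (e : ℕ) : Option (ℕ × List Bool) :=
  if p.2.idxOf e < p.2.length then none
  else ((Code.evaln b (Denumerable.ofNat Code e) (encode p.1)).bind
    (decode (α := List Bool))).map (Prod.mk e)

/-- Grant the first request available with bound `b`, and append a bit in any case. -/
def extend (b : ℕ) (p : Stage) : Stage :=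
  (firstBelow (request b p) b).elim (p.1 ++ [false], p.2)
    fun r => (p.1 ++ r.2 ++ [false], r.1 :: p.2)

/-- The stages of the construction guided by `f`. -/
def stage (f : ℕ → ℕ) (n : ℕ) : Stage := n.rec ([], []) fun k p => extend (f k) p

/-- The limit of the construction guided by `f`. -/
def limitSet (f : ℕ → ℕ) (n : ℕ) : Bool := ((stage f (n + 1)).1[n]?).getD false

theorem primrec_request : Primrec fun q : (ℕ × Stage) × ℕ => request q.1.1 q.1.2 q.2 := by
  have hσ : Primrec fun q : (ℕ × Stage) × ℕ => q.1.2.1 :=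
    Primrec.fst.comp (Primrec.snd.comp Primrec.fst)
  have hL : Primrec fun q : (ℕ × Stage) × ℕ => q.1.2.2 :=
    Primrec.snd.comp (Primrec.snd.comp Primrec.fst)
  refine Primrec.ite (Primrec.nat_lt.comp (Primrec.list_idxOf.comp Primrec.snd hL)
    (Primrec.list_length.comp hL)) (Primrec.const none) ?_
  refine Primrec.option_map (Primrec.option_bind (Code.primrec_evaln.comp
    (((Primrec.fst.comp Primrec.fst).pair ((Primrec.ofNat Code).comp Primrec.snd)).pair
      (Primrec.encode.comp hσ))) (Primrec.decode.comp Primrec.snd).to₂) ?_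
  exact ((Primrec.snd.comp Primrec.fst).pair Primrec.snd).to₂

theorem computable_extend : Computable₂ extend := by
  have hfirst : Primrec fun q : ℕ × Stage => firstBelow (request q.1 q.2) q.1 :=
    Primrec.nat_rec' Primrec.fst (Primrec.const none)
      (Primrec.option_orElse.comp (Primrec.snd.comp Primrec.snd)
        (primrec_request.comp (Primrec.fst.pair (Primrec.fst.comp Primrec.snd)))).to₂
  have hbit {α : Type} [Primcodable α] {g : α → List Bool} (hg : Primrec g) :
      Primrec fun a => g a ++ [false] := Primrec.list_append.comp hg (Primrec.const [false])
  have := Primrec.option_casesOn hfirst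
    (g := fun q r => ((q.2.1 ++ r.2 ++ [false], r.1 :: q.2.2) : Stage))
    ((hbit (Primrec.fst.comp Primrec.snd)).pair (Primrec.snd.comp Primrec.snd))
    ((hbit (Primrec.list_append.comp (Primrec.fst.comp (Primrec.snd.comp Primrec.fst))
        (Primrec.snd.comp Primrec.snd))).pair
      (Primrec.list_cons.comp (Primrec.fst.comp Primrec.snd)
        (Primrec.snd.comp (Primrec.snd.comp Primrec.fst)))).to₂
  refine (this.of_eq fun q => ?_).to_comp
  unfold extend
  cases firstBelow (request q.1 q.2) q.1 <;> rfl

theorem ComputableIn.limitSet {A : Set ℕ} {f : ℕ → ℕ} (hf : ComputableIn A f) :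
    ComputableIn A (limitSet f) := by
  have hstage : ComputableIn A (stage f) := hf.iterate computable_extend fun _ => rfl
  have hbit : Computable fun q : Stage × ℕ => (q.1.1[q.2]?).getD false :=
    Computable.option_getD (Computable.list_getElem?.comp
      (Computable.fst.comp Computable.fst) Computable.snd) (Computable.const false)
  exact (ComputableIn.of_computable hbit).comp
    ((hstage.comp (.of_computable Computable.succ)).pair (.of_computable Computable.id))

theorem request_eq_some_iff {b : ℕ} {p : Stage} {e : ℕ} {r : ℕ × List Bool} :
    request b p e = some r ↔ e ∉ p.2 ∧ r.1 = e ∧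
      ∃ m ∈ Code.evaln b (Denumerable.ofNat Code e) (encode p.1), decode m = some r.2 := by
  simp only [request, List.idxOf_lt_length_iff]
  split_ifs with h
  · simp [h]
  · simp only [Option.map_eq_some_iff, Option.bind_eq_some_iff, h, not_false_eq_true, true_and]
    constructor
    · rintro ⟨τ, ⟨m, hm, hd⟩, rfl⟩
      exact ⟨rfl, m, hm, hd⟩
    · rintro ⟨rfl, m, hm, hd⟩
      exact ⟨r.2, ⟨m, hm, hd⟩, rfl⟩

theorem extend_of_eq_some {b : ℕ} {p : Stage} {r : ℕ × List Bool}
    (h : firstBelow (request b p) b = some r) :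
    extend b p = (p.1 ++ r.2 ++ [false], r.1 :: p.2) := by
  simp [extend, h]

theorem extend_of_eq_none {b : ℕ} {p : Stage} (h : firstBelow (request b p) b = none) :
    extend b p = (p.1 ++ [false], p.2) := by
  simp [extend, h]

section Stages

variable (f : ℕ → ℕ)

theorem stage_succ (n : ℕ) : stage f (n + 1) = extend (f n) (stage f n) := rfl

/-- The request granted at stage `n`, if any. -/
def granted (n : ℕ) : Option (ℕ × List Bool) := firstBelow (request (f n) (stage f n)) (f n)

theorem exists_stage_succ_fst (n : ℕ) :
    ∃ τ, (stage f (n + 1)).1 = (stage f n).1 ++ τ ++ [false] := by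
  rw [stage_succ]
  cases h : granted f n with
  | none => exact ⟨[], by simp [extend_of_eq_none h]⟩
  | some r => exact ⟨r.2, by rw [extend_of_eq_some h]⟩

theorem stage_fst_prefix {m n : ℕ} (h : m ≤ n) : (stage f m).1 <+: (stage f n).1 := by
  induction n, h using Nat.le_induction with
  | base => exact List.prefix_rfl
  | succ n _ ih =>
    obtain ⟨τ, hτ⟩ := exists_stage_succ_fst f n
    exact ih.trans (hτ ▸ by simp [List.append_assoc])

theorem le_length_stage (n : ℕ) : n ≤ (stage f n).1.length := by
  induction n with
  | zero => exact Nat.zero_le _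
  | succ n ih =>
    obtain ⟨τ, hτ⟩ := exists_stage_succ_fst f n
    simp only [hτ, List.length_append, List.length_singleton]
    omega

theorem ofFn_limitSet {σ : List Bool} {n : ℕ} (h : σ <+: (stage f n).1) :
    (List.ofFn fun i : Fin σ.length => limitSet f i) = σ := by
  refine List.ext_getElem (by simp) fun i h1 h2 => ?_
  have hi := le_length_stage f (i + 1)
  have hσ : (stage f (max n (i + 1))).1[i]? = some σ[i] :=
    List.prefix_iff_getElem?.1 (h.trans (stage_fst_prefix f (le_max_left _ _))) i h2
  have hs : (stage f (max n (i + 1))).1[i]? = some (stage f (i + 1)).1[i] :=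
    List.prefix_iff_getElem?.1 (stage_fst_prefix f (le_max_right _ _)) i hi
  simp only [List.getElem_ofFn, limitSet, List.getElem?_eq_getElem hi, Option.getD_some]
  exact Option.some_injective _ (hs.symm.trans hσ)

theorem mem_stage_of_le {m n e : ℕ} (h : m ≤ n) (he : e ∈ (stage f m).2) : e ∈ (stage f n).2 := by
  induction n, h using Nat.le_induction with
  | base => exact he
  | succ n _ ih =>
    rw [stage_succ]
    cases h : granted f n with
    | none => rwa [extend_of_eq_none h]
    | some r => exact extend_of_eq_some h ▸ List.mem_cons_of_mem _ ih

theorem mem_stage_succ_of_granted {n : ℕ} {r : ℕ × List Bool} (h : granted f n = some r) :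
    r.1 ∈ (stage f (n + 1)).2 := by
  rw [stage_succ, extend_of_eq_some h]
  exact List.mem_cons_self

theorem exists_granted_of_mem_stage {n e : ℕ} (he : e ∈ (stage f n).2) :
    ∃ m, ∃ r, granted f m = some r ∧ r.1 = e := by
  induction n with
  | zero => simp [stage] at he
  | succ n ih =>
    rw [stage_succ] at he
    cases h : granted f n with
    | none => exact ih (by rwa [extend_of_eq_none h] at he)
    | some r =>
      rw [extend_of_eq_some h] at he
      rcases List.mem_cons.1 he with rfl | he
      exacts [⟨n, r, h, rfl⟩, ih he]

theorem request_of_granted {n : ℕ} {r : ℕ × List Bool} (h : granted f n = some r) :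
    request (f n) (stage f n) r.1 = some r := by
  obtain ⟨k, -, hk⟩ := exists_of_firstBelow_eq_some h
  rwa [(request_eq_some_iff.1 hk).2.1]

/-- Each requirement receives attention at most once. -/
theorem eventually_not_granted (e : ℕ) : ∀ᶠ n in atTop, ∀ r, granted f n = some r → r.1 ≠ e := by
  by_cases h : ∃ m r, granted f m = some r ∧ r.1 = e
  · obtain ⟨m, r, hm, rfl⟩ := h
    filter_upwards [eventually_ge_atTop (m + 1)] with n hn r' hr' heq
    refine (request_eq_some_iff.1 (request_of_granted f hr')).1 ?_
    exact heq ▸ mem_stage_of_le f hn (mem_stage_succ_of_granted f hm)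
  · push Not at h
    exact .of_forall h

end Stages

theorem exists_computable_extension {V : Set (List Bool)} (hV : ComputableStringSet V)
    (hd : DenseStringSet V) : ∃ g : List Bool → List Bool, Computable g ∧ ∀ σ, σ ++ g σ ∈ V := by
  obtain ⟨χ, hχ, hVχ⟩ := hV
  let ext : ℕ → List Bool := fun n => (decode n).getD []
  have hext : Computable ext := Computable.option_getD Computable.decode (Computable.const [])
  have hex (σ : List Bool) : ∃ n, χ (σ ++ ext n) = true := by
    obtain ⟨_, hτ, ρ, rfl⟩ := hd σ
    exact ⟨encode ρ, by simpa [ext] using (hVχ _).1 hτ⟩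
  refine ⟨fun σ => ext (Nat.find (hex σ)), hext.comp (computable_find ?_ hex),
    fun σ => (hVχ _).2 (Nat.find_spec (hex σ))⟩
  exact (hχ.comp (Computable.list_append.comp Computable.fst (hext.comp Computable.snd))).to₂

/-- Every requirement given by a total computable function is eventually met. -/
theorem exists_granted {f : ℕ → ℕ}
    (hf : ∀ g : ℕ → ℕ, Computable g → ∃ᶠ n in atTop, g n ≤ f n) {g : List Bool → List Bool}
    {c : Code} (hc : ∀ σ, encode (g σ) ∈ c.eval (encode σ)) :
    ∃ n r, granted f n = some r ∧ r.1 = encode c := by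
  by_contra! hcon
  have hex (p : Stage) :
      ∃ b, (decide (encode c < b) && (Code.evaln b c (encode p.1)).isSome) = true := by
    obtain ⟨k, hk⟩ := Code.evaln_complete.1 (hc p.1)
    refine ⟨max k (encode c + 1), ?_⟩
    have := Code.evaln_mono (le_max_left k (encode c + 1)) hk
    rw [Option.mem_def] at this
    simp [this]
  have htime : Computable fun p : Stage => Nat.find (hex p) := by
    refine computable_find ?_ hex
    refine (Primrec.and.comp (Primrec.nat_lt.decide.comp (Primrec.const _) Primrec.snd)
      (Primrec.option_isSome.comp (Code.primrec_evaln.comp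
        ((Primrec.snd.pair (Primrec.const c)).pair
          (Primrec.encode.comp (Primrec.fst.comp Primrec.fst)))))).to_comp
  have hfreq := frequently_le_of_iterate hf computable_extend (stage_succ f) htime
  have hprior : ∀ᶠ n in atTop, ∀ e < encode c, ∀ r, granted f n = some r → r.1 ≠ e :=
    (eventually_all_finite (Set.finite_lt_nat (encode c))).2 fun e _ => eventually_not_granted f e
  obtain ⟨n, hle, hn⟩ := (hfreq.and_eventually hprior).exists
  obtain ⟨hlt, hsome⟩ := Bool.and_eq_true_iff.1 (Nat.find_spec (hex (stage f n)))
  obtain ⟨m, hm⟩ := Option.isSome_iff_exists.1 hsome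
  have hmf := Code.evaln_mono hle hm
  have hmg : m = encode (g (stage f n).1) := Part.mem_unique (Code.evaln_sound hm) (hc _)
  have hreq : request (f n) (stage f n) (encode c) = some (encode c, g (stage f n).1) := by
    refine request_eq_some_iff.2 ⟨fun hmem => ?_, rfl, m, by simpa using hmf, by simp [hmg]⟩
    obtain ⟨k, r, hk, hr⟩ := exists_granted_of_mem_stage f hmem
    exact hcon k r hk hr
  obtain ⟨j, hj, r, hr, hjr⟩ :=
    exists_firstBelow_of_eq_some ((of_decide_eq_true hlt).trans_le hle) hreq
  have hrj := (request_eq_some_iff.1 hjr).2.1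
  rcases hj.lt_or_eq with hlt | rfl
  · exact hn j hlt r hr hrj
  · exact hcon n r hr hrj

theorem weakly1Generic_limitSet {f : ℕ → ℕ}
    (hf : ∀ g : ℕ → ℕ, Computable g → ∃ᶠ n in atTop, g n ≤ f n) :
    Weakly1Generic (limitSet f) := by
  intro V hV hd
  obtain ⟨g, hg, hgV⟩ := exists_computable_extension hV hd
  obtain ⟨c, hc⟩ := Code.exists_code.1 hg
  have hc' (σ : List Bool) : encode (g σ) ∈ c.eval (encode σ) := by simp [hc]
  obtain ⟨n, r, hr, hrc⟩ := exists_granted hf hc'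
  obtain ⟨-, -, m, hm, hdec⟩ := request_eq_some_iff.1 (request_of_granted f hr)
  rw [hrc, Denumerable.ofNat_encode] at hm
  have hmg : m = encode (g (stage f n).1) := Part.mem_unique (Code.evaln_sound hm) (hc' _)
  have hrg : g (stage f n).1 = r.2 := by simpa [hmg] using hdec
  have hpre : (stage f n).1 ++ g (stage f n).1 <+: (stage f (n + 1)).1 := by
    rw [stage_succ, extend_of_eq_some hr, hrg]
    exact List.prefix_append _ _
  exact ⟨_, (ofFn_limitSet f hpre).symm ▸ hgV _⟩

end Generic

/-- `A ∈ 𝒟(≠*)` (some `f ≤_T A` agrees infinitely often with every total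
computable function) iff `A` computes a weakly 1-generic element of Cantor space. -/
theorem stmt0 (A : Set ℕ) :
    (∃ f : ℕ → ℕ, ComputableIn A f ∧
        ∀ h : ℕ → ℕ, Computable h → ∃ᶠ n in atTop, f n = h n) ↔
    (∃ x : ℕ → Bool, ComputableIn A x ∧ Weakly1Generic x) := by
  refine ⟨fun ⟨f, hfA, hf⟩ => ⟨limitSet f, hfA.limitSet, weakly1Generic_limitSet fun g hg => ?_⟩,
    fun ⟨x, hxA, hx⟩ => hx.exists_infinitely_often_equal hxA⟩
  exact (hf g hg).mono fun n hn => hn.ge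

end CichonAnalog
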